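/- arXiv:2509.17578 — 2 statements merged into one kernel-verified Lean document; each statement's English description precedes it below -/
import Mathlib

section
/- Let p ≥ 2 and let A_p = [−π, π] if p is an even integer and A_p = [−π/2 + π/p, 3π/2 − π/p] otherwise. Then for every z = |z| e^{it} with t ∈ A_p, one has |z|^p ≤ m_p |Re z|^p + n_p |z|^p cos(p(π/2 − t)), where m_p = csc^p(π/(2p)) and n_p = cot(π/(2p)). -/
/-- `m_p = csc^p(π/(2p))`. -/
noncomputable def mP (p : ℝ) : ℝ := (Real.sin (Real.pi / (2 * p)))⁻¹ ^ p

/-- `n_p = cot(π/(2p))`. -/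
noncomputable def nP (p : ℝ) : ℝ := Real.cot (Real.pi / (2 * p))

open Classical in
/-- `A_p = [-π, π]` if `p` is an even integer, `[-π/2 + π/p, 3π/2 - π/p]` otherwise. -/
noncomputable def Ap (p : ℝ) : Set ℝ :=
  if ∃ n : ℤ, p = 2 * (n : ℝ) then Set.Icc (-Real.pi) Real.pi
  else Set.Icc (-(Real.pi / 2) + Real.pi / p) (3 * Real.pi / 2 - Real.pi / p)

open Real Set in
lemma sin_mul_le_mul_cos_mul_sin {p s : ℝ} (hp : 2 ≤ p) (hs : 0 ≤ s) (hps : p * s ≤ π) :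
    sin (p * s) ≤ p * (cos s * sin ((p - 1) * s)) := by
  have hcos : 0 ≤ cos s := cos_nonneg_of_mem_Icc ⟨by linarith [pi_pos], by nlinarith⟩
  have hsin : 0 ≤ sin ((p - 1) * s) :=
    sin_nonneg_of_nonneg_of_le_pi (by nlinarith) (by nlinarith)
  have hdiff : 0 ≤ sin ((p - 2) * s) :=
    sin_nonneg_of_nonneg_of_le_pi (by nlinarith) (by nlinarith)
  have hadd : sin (p * s) = sin ((p - 1) * s) * cos s + cos ((p - 1) * s) * sin s := by
    rw [← sin_add]; ring_nf
  have hsub : sin ((p - 2) * s) = sin ((p - 1) * s) * cos s - cos ((p - 1) * s) * sin s := by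
    rw [← sin_sub]; ring_nf
  nlinarith [mul_nonneg hcos hsin]

open Real Set in
lemma monotoneOn_sin_rpow_mul_cos_div_sin {p : ℝ} (hp : 2 ≤ p) :
    MonotoneOn (fun s => sin s ^ (p - 1) * cos s / sin (p * s)) (Ioo 0 (π / p)) := by
  have hp0 : 0 < p := by linarith
  have hbound : ∀ s ∈ Ioo 0 (π / p), 0 < s ∧ p * s < π ∧ 0 < sin s ∧ 0 < sin (p * s) := by
    rintro s ⟨h0, h1⟩
    have h2 : p * s < π := by rwa [lt_div_iff₀ hp0, mul_comm] at h1
    exact ⟨h0, h2, sin_pos_of_pos_of_lt_pi h0 (by nlinarith),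
      sin_pos_of_pos_of_lt_pi (by positivity) h2⟩
  have hderiv : ∀ s ∈ Ioo 0 (π / p),
      HasDerivAt (fun s => sin s ^ (p - 1) * cos s / sin (p * s))
        (sin s ^ (p - 2) * (p * (cos s * sin ((p - 1) * s)) - sin (p * s)) / sin (p * s) ^ 2)
        s := by
    intro s hs
    obtain ⟨-, -, h2, h3⟩ := hbound s hs
    have hnum := ((hasDerivAt_sin s).rpow_const (p := p - 1) (Or.inl h2.ne')).mul
      (hasDerivAt_cos s)
    have hden := ((hasDerivAt_id s).const_mul p).sin
    refine (hnum.div hden h3.ne').congr_deriv ?_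
    have hpow : sin s ^ (p - 1) = sin s ^ (p - 2) * sin s := by
      rw [← rpow_add_one h2.ne']; ring_nf
    have hpow' : p - 1 - 1 = p - 2 := by ring
    have hsub : sin ((p - 1) * s) = sin (p * s) * cos s - cos (p * s) * sin s := by
      rw [← sin_sub]; ring_nf
    simp only [Pi.mul_apply, id, hpow', hpow, hsub]
    congr 1
    linear_combination (-(sin s ^ (p - 2)) * sin (p * s)) * sin_sq_add_cos_sq s
  refine monotoneOn_of_deriv_nonneg (convex_Ioo _ _)
    (fun s hs => (hderiv s hs).continuousAt.continuousWithinAt)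
    (fun s hs => (hderiv s (interior_subset hs)).differentiableAt.differentiableWithinAt)
    fun s hs => ?_
  rw [interior_Ioo] at hs
  obtain ⟨h0, h1, h2, -⟩ := hbound s hs
  rw [(hderiv s hs).deriv]
  have := sin_mul_le_mul_cos_mul_sin hp h0.le h1.le
  exact div_nonneg (mul_nonneg (rpow_nonneg h2.le _) (by linarith)) (sq_nonneg _)

open Real Set in
lemma sin_pi_div_two_mul_pos {p : ℝ} (hp : 2 ≤ p) : 0 < sin (π / (2 * p)) :=
  sin_pos_of_pos_of_lt_pi (by have := pi_pos; positivity)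
    (div_lt_self pi_pos (by linarith))

lemma mP_pos {p : ℝ} (hp : 2 ≤ p) : 0 < mP p :=
  Real.rpow_pos_of_pos (inv_pos.2 (sin_pi_div_two_mul_pos hp)) _

open Real Set in
lemma nP_nonneg {p : ℝ} (hp : 2 ≤ p) : 0 ≤ nP p := by
  rw [nP, cot_eq_cos_div_sin]
  have h0 : 0 < π / (2 * p) := by have := pi_pos; positivity
  refine div_nonneg (cos_nonneg_of_mem_Icc ⟨by linarith [pi_pos], ?_⟩)
    (sin_pi_div_two_mul_pos hp).le
  exact div_le_div_of_nonneg_left pi_pos.le two_pos (by linarith)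

lemma mP_mul_sin_rpow {p : ℝ} (hp : 2 ≤ p) :
    mP p * Real.sin (Real.pi / (2 * p)) ^ p = 1 := by
  have h := sin_pi_div_two_mul_pos hp
  rw [mP, ← Real.mul_rpow (inv_nonneg.2 h.le) h.le, inv_mul_cancel₀ h.ne', Real.one_rpow]

open Real Set in
lemma one_le_mP_sin_add_nP_cos_of_le_pi_div {p s : ℝ} (hp : 2 ≤ p) (hs : s ∈ Icc 0 (π / p)) :
    1 ≤ mP p * sin s ^ p + nP p * cos (p * s) := by
  have hp0 : 0 < p := by linarith
  have hpi := pi_pos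
  set c := π / (2 * p) with hc
  have hc0 : 0 < c := by positivity
  have hc1 : c < π / p := by
    rw [hc]; exact div_lt_div_of_pos_left hpi hp0 (by linarith)
  have hpc : p * c = π / 2 := by rw [hc]; field_simp
  have hsc : 0 < sin c := sin_pi_div_two_mul_pos hp
  have hmc : mP p * sin c ^ p = 1 := mP_mul_sin_rpow hp
  have hratio : mP p * (sin c ^ (p - 1) * cos c / sin (p * c)) = nP p := by
    rw [hpc, sin_pi_div_two, rpow_sub_one hsc.ne', nP, ← hc, cot_eq_cos_div_sin]
    linear_combination (cos c / sin c) * hmc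
  have hsinp : ∀ x ∈ Ioo 0 (π / p), 0 < sin (p * x) := by
    rintro x ⟨h0, h1⟩
    exact sin_pos_of_pos_of_lt_pi (by positivity) (by rwa [lt_div_iff₀ hp0, mul_comm] at h1)
  have hderiv : ∀ x, HasDerivAt (fun x => mP p * sin x ^ p + nP p * cos (p * x))
      (p * (mP p * (sin x ^ (p - 1) * cos x) - nP p * sin (p * x))) x := by
    intro x
    refine ((((hasDerivAt_sin x).rpow_const (p := p) (Or.inr (by linarith))).const_mul
      (mP p)).add ((((hasDerivAt_id x).const_mul p).cos).const_mul (nP p))).congr_deriv ?_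
    simp only [id]; ring
  have hcont : Continuous (fun x => mP p * sin x ^ p + nP p * cos (p * x)) :=
    continuous_iff_continuousAt.2 fun x => (hderiv x).continuousAt
  have hfactor : ∀ x ∈ Ioo 0 (π / p),
      p * (mP p * (sin x ^ (p - 1) * cos x) - nP p * sin (p * x)) = p * sin (p * x) *
        (mP p * (sin x ^ (p - 1) * cos x / sin (p * x)
          - sin c ^ (p - 1) * cos c / sin (p * c))) := by
    intro x hx
    have := (hsinp x hx).ne'
    rw [mul_sub (mP p), hratio]; field_simp
  have hmono := monotoneOn_sin_rpow_mul_cos_div_sin hp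
  have hfc : mP p * sin c ^ p + nP p * cos (p * c) = 1 := by
    rw [hpc, cos_pi_div_two, hmc]; ring
  rw [← hfc]
  rcases le_total s c with hle | hle
  · have hanti : AntitoneOn (fun x => mP p * sin x ^ p + nP p * cos (p * x)) (Icc 0 c) := by
      refine antitoneOn_of_deriv_nonpos (convex_Icc _ _) hcont.continuousOn
        (fun x _ => (hderiv x).differentiableAt.differentiableWithinAt) fun x hx => ?_
      rw [interior_Icc] at hx
      have hx' : x ∈ Ioo 0 (π / p) := ⟨hx.1, hx.2.trans hc1⟩
      rw [(hderiv x).deriv, hfactor x hx']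
      exact mul_nonpos_of_nonneg_of_nonpos (mul_pos hp0 (hsinp x hx')).le
        (mul_nonpos_of_nonneg_of_nonpos (mP_pos hp).le
          (sub_nonpos.2 (hmono hx' ⟨hc0, hc1⟩ hx.2.le)))
    exact hanti ⟨hs.1, hle⟩ ⟨hc0.le, le_rfl⟩ hle
  · have hmon : MonotoneOn (fun x => mP p * sin x ^ p + nP p * cos (p * x))
        (Icc c (π / p)) := by
      refine monotoneOn_of_deriv_nonneg (convex_Icc _ _) hcont.continuousOn
        (fun x _ => (hderiv x).differentiableAt.differentiableWithinAt) fun x hx => ?_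
      rw [interior_Icc] at hx
      have hx' : x ∈ Ioo 0 (π / p) := ⟨hc0.trans hx.1, hx.2⟩
      rw [(hderiv x).deriv, hfactor x hx']
      exact mul_nonneg (mul_pos hp0 (hsinp x hx')).le
        (mul_nonneg (mP_pos hp).le (sub_nonneg.2 (hmono ⟨hc0, hc1⟩ hx' hx.1.le)))
    exact hmon ⟨le_rfl, hc1.le⟩ ⟨hle, hs.2⟩ hle

open Real Set in
lemma one_le_mP_sin_add_nP_cos {p s : ℝ} (hp : 2 ≤ p) (hs : s ∈ Icc 0 (π - π / p)) :
    1 ≤ mP p * |sin s| ^ p + nP p * cos (p * s) := by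
  have hp0 : 0 < p := by linarith
  have hpi := pi_pos
  have hdiv : 0 < π / p := by positivity
  have hdiv2 : π / p ≤ π / 2 := div_le_div_of_nonneg_left hpi.le two_pos hp
  rw [abs_of_nonneg (sin_nonneg_of_nonneg_of_le_pi hs.1 (by linarith [hs.2]))]
  rcases le_total s (π / p) with h | h
  · exact one_le_mP_sin_add_nP_cos_of_le_pi_div hp ⟨hs.1, h⟩
  · have hsin : sin (π / p) ≤ sin s := by
      rcases le_total s (π / 2) with h2 | h2
      · exact sin_le_sin_of_le_of_le_pi_div_two (by linarith) h2 h
      · rw [← sin_pi_sub s]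
        exact sin_le_sin_of_le_of_le_pi_div_two (by linarith) (by linarith) (by linarith [hs.2])
    have hend := one_le_mP_sin_add_nP_cos_of_le_pi_div hp (right_mem_Icc.2 hdiv.le)
    rw [mul_div_cancel₀ _ hp0.ne', cos_pi] at hend
    have hpow : sin (π / p) ^ p ≤ sin s ^ p :=
      rpow_le_rpow (sin_nonneg_of_nonneg_of_le_pi hdiv.le (by linarith)) hsin hp0.le
    have h1 := mul_le_mul_of_nonneg_left hpow (mP_pos hp).le
    have h2 := mul_le_mul_of_nonneg_left (neg_one_le_cos (p * s)) (nP_nonneg hp)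
    linarith

open Real Set in
lemma one_le_mP_sin_add_nP_cos_of_abs_le {p s : ℝ} (hp : 2 ≤ p) (hs : |s| ≤ π - π / p) :
    1 ≤ mP p * |sin s| ^ p + nP p * cos (p * s) := by
  have h := one_le_mP_sin_add_nP_cos hp ⟨abs_nonneg s, hs⟩
  rcases abs_choice s with h' | h' <;> rw [h'] at h
  · exact h
  · simpa using h

open Real Set in
lemma one_le_mP_sin_add_nP_cos_of_mem_Ap {p t : ℝ} (hp : 2 ≤ p) (ht : t ∈ Ap p) :
    1 ≤ mP p * |sin (π / 2 - t)| ^ p + nP p * cos (p * (π / 2 - t)) := by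
  have hdiv2 : π / p ≤ π / 2 := div_le_div_of_nonneg_left pi_pos.le two_pos hp
  unfold Ap at ht
  split_ifs at ht with heven
  · obtain ⟨n, hn⟩ := heven
    rcases le_total 0 t with h | h
    · exact one_le_mP_sin_add_nP_cos_of_abs_le hp
        (abs_le.2 ⟨by linarith [ht.2], by linarith⟩)
    · have hshift := one_le_mP_sin_add_nP_cos_of_abs_le (s := π / 2 - t - π) hp
        (abs_le.2 ⟨by linarith, by linarith [ht.1]⟩)
      have hcos : cos (p * (π / 2 - t - π)) = cos (p * (π / 2 - t)) := by
        rw [← cos_sub_int_mul_two_pi (p * (π / 2 - t)) n, hn]; ring_nf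
      rwa [sin_sub_pi, abs_neg, hcos] at hshift
  · exact one_le_mP_sin_add_nP_cos_of_abs_le hp
      (abs_le.2 ⟨by linarith [ht.2], by linarith [ht.1]⟩)


/-- For `p ≥ 2` and `z = |z| e^{it}` with `t ∈ A_p`:
`|z|^p ≤ m_p |Re z|^p + n_p |z|^p cos(p(π/2 - t))`. -/
theorem abs_rpow_le_mP_re_add_nP_cos (p : ℝ) (hp : 2 ≤ p) (z : ℂ) (t : ℝ)
    (ht : t ∈ Ap p) (hz : z = (‖z‖ : ℂ) * Complex.exp ((t : ℂ) * Complex.I)) :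
    ‖z‖ ^ p ≤ mP p * |z.re| ^ p + nP p * ‖z‖ ^ p * Real.cos (p * (Real.pi / 2 - t)) := by
  have hre : z.re = ‖z‖ * Real.sin (Real.pi / 2 - t) := by
    rw [Real.sin_pi_div_two_sub]
    conv_lhs => rw [hz]
    rw [Complex.re_ofReal_mul, Complex.exp_ofReal_mul_I_re]
  have h := mul_le_mul_of_nonneg_left (one_le_mP_sin_add_nP_cos_of_mem_Ap hp ht)
    (Real.rpow_nonneg (norm_nonneg z) p)
  rw [hre, abs_mul, abs_norm, Real.mul_rpow (norm_nonneg z) (abs_nonneg _)]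
  linarith
end

section
/- For every real p ≥ 2, one has cos^p(π/(2p)) ≥ 1/2; equivalently, the function p ↦ cos^p(π/(2p)) is nondecreasing on [2, ∞) with infimum attained in the limit p → ∞ equal to 1, and at p = 2 its value is 1/2. -/
open Real Set Filter Topology in
theorem concaveOn_log_cos : ConcaveOn ℝ (Ioo (-(π / 2)) (π / 2)) fun x => log (cos x) := by
  have hd : ∀ x ∈ Ioo (-(π / 2)) (π / 2), HasDerivAt (fun x => log (cos x)) (-tan x) x := by
    intro x hx
    have h := (hasDerivAt_cos x).log (cos_pos_of_mem_Ioo hx).ne'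
    rwa [neg_div, ← tan_eq_sin_div_cos] at h
  refine AntitoneOn.concaveOn_of_deriv (convex_Ioo _ _)
    (fun x hx => (hd x hx).continuousAt.continuousWithinAt) ?_ ?_
  · rw [interior_Ioo]
    exact fun x hx => (hd x hx).differentiableAt.differentiableWithinAt
  · rw [interior_Ioo]
    intro x hx y hy hxy
    rw [(hd x hx).deriv, (hd y hy).deriv]
    exact neg_le_neg (strictMonoOn_tan.monotoneOn hx hy hxy)

open Real Set in
theorem pi_div_two_mul_mem_Ioo {p : ℝ} (hp : 1 < p) :
    π / (2 * p) ∈ Ioo (-(π / 2)) (π / 2) := by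
  have h0 : 0 < π / (2 * p) := by positivity
  refine ⟨by linarith [pi_pos], ?_⟩
  exact div_lt_div_of_pos_left pi_pos two_pos (by linarith)

open Real Set in
theorem monotoneOn_cos_pi_div_two_mul_rpow :
    MonotoneOn (fun p : ℝ => cos (π / (2 * p)) ^ p) (Ioi 1) := by
  intro p hp q hq hpq
  rw [mem_Ioi] at hp hq
  have hmp := pi_div_two_mul_mem_Ioo hp
  have hmq := pi_div_two_mul_mem_Ioo hq
  have hp0 : 0 < p := by linarith
  have hq0 : 0 < q := by linarith
  have h0 : (0 : ℝ) ∈ Ioo (-(π / 2)) (π / 2) := ⟨by linarith [pi_pos], by linarith [pi_pos]⟩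
  have h := concaveOn_log_cos.2 hmp h0 (div_nonneg hp0.le hq0.le)
    (sub_nonneg.2 ((div_le_one hq0).2 hpq)) (add_sub_cancel (p / q) 1)
  have hx : p / q * (π / (2 * p)) = π / (2 * q) := by field_simp
  simp only [smul_eq_mul, mul_zero, add_zero, cos_zero, log_one, hx] at h
  simp only [rpow_def_of_pos (cos_pos_of_mem_Ioo hmp), rpow_def_of_pos (cos_pos_of_mem_Ioo hmq)]
  refine exp_le_exp.2 ?_
  rw [div_mul_eq_mul_div, div_le_iff₀ hq0] at h
  linarith

open Real Set Filter Topology in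
theorem tendsto_cos_pi_div_two_mul_rpow :
    Tendsto (fun p : ℝ => cos (π / (2 * p)) ^ p) atTop (𝓝 1) := by
  have hlim : Tendsto (fun p : ℝ => 1 - π ^ 2 / 8 / p) atTop (𝓝 1) := by
    simpa using (tendsto_id.const_div_atTop (π ^ 2 / 8)).const_sub (1 : ℝ)
  refine tendsto_of_tendsto_of_tendsto_of_le_of_le' hlim tendsto_const_nhds ?_ ?_
  · filter_upwards [eventually_ge_atTop 2] with p hp
    have hp0 : 0 < p := by linarith
    have hx0 : 0 < π / (2 * p) := by positivity
    have hx1 : π / (2 * p) ≤ 1 := by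
      rw [div_le_one (by positivity)]
      linarith [pi_le_four]
    have hb := one_add_mul_self_le_rpow_one_add (s := -((π / (2 * p)) ^ 2 / 2)) (by nlinarith)
      (p := p) (by linarith)
    calc 1 - π ^ 2 / 8 / p = 1 + p * -((π / (2 * p)) ^ 2 / 2) := by field_simp; ring
      _ ≤ (1 + -((π / (2 * p)) ^ 2 / 2)) ^ p := hb
      _ ≤ cos (π / (2 * p)) ^ p := by
        refine rpow_le_rpow (by nlinarith) ?_ hp0.le
        linarith [one_sub_sq_div_two_le_cos (x := π / (2 * p))]
  · filter_upwards [eventually_gt_atTop 1] with p hp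
    exact rpow_le_one (cos_pos_of_mem_Ioo (pi_div_two_mul_mem_Ioo hp)).le (cos_le_one _)
      (by linarith)

open Real in
theorem cos_pi_div_two_mul_two_rpow_two : cos (π / (2 * 2)) ^ (2 : ℝ) = 1 / 2 := by
  rw [show π / (2 * 2) = π / 4 by ring, cos_pi_div_four, rpow_two, div_pow,
    sq_sqrt zero_le_two]
  norm_num

/-- For `p ≥ 2`, `cos^p(π/(2p)) ≥ 1/2`; the function `p ↦ cos^p(π/(2p))` is
nondecreasing on `[2, ∞)`, tends to `1` as `p → ∞`, and equals `1/2` at `p = 2`. -/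
theorem cos_rpow_pi_div_two_p_ge_half :
    (∀ p : ℝ, 2 ≤ p → (1:ℝ) / 2 ≤ Real.cos (Real.pi / (2 * p)) ^ p) ∧
    MonotoneOn (fun p : ℝ => Real.cos (Real.pi / (2 * p)) ^ p) (Set.Ici 2) ∧
    Filter.Tendsto (fun p : ℝ => Real.cos (Real.pi / (2 * p)) ^ p)
      Filter.atTop (nhds 1) ∧
    Real.cos (Real.pi / (2 * 2)) ^ (2:ℝ) = 1 / 2 := by
  have hmono := monotoneOn_cos_pi_div_two_mul_rpow.mono
    (Set.Ici_subset_Ioi.2 (one_lt_two : (1 : ℝ) < 2))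
  refine ⟨fun p hp => ?_, hmono, tendsto_cos_pi_div_two_mul_rpow,
    cos_pi_div_two_mul_two_rpow_two⟩
  exact cos_pi_div_two_mul_two_rpow_two.symm.trans_le
    (hmono (Set.mem_Ici.2 le_rfl) (Set.mem_Ici.2 hp) hp)
end
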